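/- Let 0 < α < 1, q ∈ (2/α, ∞) and T > 0. There exists a constant c > 0, depending only on α, q and T, with the following property. Let V be a nontrivial finite-dimensional complex inner product space, A : V → V a self-adjoint positive definite linear operator, τ > 0, N ≥ 1 with Nτ ≤ T, and f^1, …, f^N ∈ V. Define U^0 = 0 and, for 1 ≤ n ≤ N, let U^n ∈ V solve ∂̄_τ^α U^n + A U^n = f^n, where ∂̄_τ^α U^n = τ^{-α} Σ_{j=0}^n b_j^{(α)} U^{n-j}. Then for every 1 ≤ n ≤ N, ‖U^n‖ + (τ Σ_{j=1}^n ‖A^{1/2} U^j‖^q)^{1/q} ≤ c · (τ Σ_{j=1}^n ‖A^{-1/2} f^j‖^q)^{1/q}. -/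

import Mathlib

open scoped ComplexInnerProductSpace

/-- The backward Euler convolution quadrature weights `b_j^(α) = (-1)^j binom(α, j)`. -/
noncomputable def cqWeight (α : ℝ) (j : ℕ) : ℝ :=
  (-1 : ℝ) ^ j * (∏ i ∈ Finset.range j, (α - i)) / (Nat.factorial j)

/-- The backward Euler CQ approximation `∂̄_τ^α φ^n = τ^{-α} Σ_{j=0}^n b_j^(α) φ^{n-j}`. -/
noncomputable def cqDeriv (α : ℝ) {V : Type} [AddCommGroup V] [Module ℝ V]
    (τ : ℝ) (φ : ℕ → V) (n : ℕ) : V :=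
  τ ^ (-α) • ∑ j ∈ Finset.range (n + 1), cqWeight α j • φ (n - j)

/-- Fractional power `A^β` via the functional (spectral) calculus. -/
noncomputable def opRPow {V : Type} [NormedAddCommGroup V] [InnerProductSpace ℂ V]
    [FiniteDimensional ℂ V] (A : V →L[ℂ] V) (β : ℝ) : V →L[ℂ] V :=
  cfc (fun x : ℝ => x ^ β) A

lemma cqWeight_zero (s : ℝ) : cqWeight s 0 = 1 := by simp [cqWeight]

lemma cqWeight_succ (s : ℝ) (n : ℕ) :
    cqWeight s (n + 1) = cqWeight s n * ((n - s) / (n + 1)) := by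
  have : (Nat.factorial n : ℝ) ≠ 0 := by positivity
  simp only [cqWeight, Finset.prod_range_succ, Nat.factorial_succ]
  push_cast
  field_simp
  ring

lemma cqWeight_eq_choose (s : ℝ) (n : ℕ) : cqWeight s n = (-1) ^ n * Ring.choose s n := by
  have h : ∀ m : ℕ, (descPochhammer ℤ m).smeval s = ∏ i ∈ Finset.range m, (s - i) := by
    intro m
    induction m with
    | zero => simp
    | succ m ih =>
      rw [descPochhammer_succ_right, Polynomial.smeval_mul, ih, Finset.prod_range_succ]
      simp [Polynomial.smeval_sub, Polynomial.smeval_natCast]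
  rw [Ring.choose_eq_smul, h, cqWeight, smul_eq_mul]
  field_simp

/-- The power series of `(1 - ξ) ^ s`, with the quadrature weights as coefficients. -/
noncomputable def cqSeries (s : ℝ) : PowerSeries ℝ := PowerSeries.mk (cqWeight s)

lemma cqSeries_eq_rescale (s : ℝ) :
    cqSeries s = PowerSeries.rescale (-1) (PowerSeries.binomialSeries ℝ s) := by
  ext n
  simp [cqSeries, cqWeight_eq_choose, PowerSeries.coeff_rescale]

lemma cqSeries_add (s t : ℝ) : cqSeries (s + t) = cqSeries s * cqSeries t := by
  simp [cqSeries_eq_rescale, PowerSeries.binomialSeries_add]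

lemma cqSeries_zero : cqSeries 0 = 1 := by
  simp [cqSeries_eq_rescale, PowerSeries.binomialSeries_zero]

lemma cqWeight_neg_pos {β : ℝ} (hβ : 0 < β) (n : ℕ) : 0 < cqWeight (-β) n := by
  induction n with
  | zero => simp [cqWeight_zero]
  | succ n ih =>
    rw [cqWeight_succ]
    have : (0 : ℝ) < n - -β := by rw [sub_neg_eq_add]; positivity
    positivity

lemma cqWeight_neg_one (n : ℕ) : cqWeight (-1) n = 1 := by
  induction n with
  | zero => simp [cqWeight_zero]
  | succ n ih =>
    rw [cqWeight_succ, ih, sub_neg_eq_add, one_mul, div_self (by positivity)]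

lemma cqWeight_neg_succ_le {β : ℝ} (hβ : 0 < β) (hβ1 : β ≤ 1) (n : ℕ) :
    cqWeight (-β) (n + 1) ≤ cqWeight (-β) n := by
  rw [cqWeight_succ]
  refine mul_le_of_le_one_right (cqWeight_neg_pos hβ n).le ?_
  rw [div_le_one (by positivity)]
  linarith

lemma cqWeight_neg_log_convex {β : ℝ} (hβ : 0 < β) (hβ1 : β ≤ 1) (n : ℕ) :
    cqWeight (-β) (n + 1) ^ 2 ≤ cqWeight (-β) n * cqWeight (-β) (n + 2) := by
  rw [show n + 2 = (n + 1) + 1 from rfl, cqWeight_succ _ (n + 1), cqWeight_succ _ n]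
  have h0 := (cqWeight_neg_pos hβ n).le
  set w := cqWeight (-β) n
  have hr : ((n : ℝ) - -β) / (n + 1) ≤ (((n + 1 : ℕ) : ℝ) - -β) / ((n + 1 : ℕ) + 1) := by
    rw [div_le_div_iff₀ (by positivity) (by positivity)]
    push_cast
    nlinarith
  have hr0 : 0 ≤ ((n : ℝ) - -β) / (n + 1) := by rw [sub_neg_eq_add]; positivity
  nlinarith [mul_le_mul_of_nonneg_left hr (mul_nonneg (mul_nonneg h0 h0) hr0)]

/-- The quadrature weights of `(1 - ξ) ^ (-α)` decay like `n ^ (α - 1)`. -/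
lemma cqWeight_neg_le_rpow {α : ℝ} (h0 : 0 < α) (h1 : α < 1) (n : ℕ) :
    cqWeight (-α) n ≤ ((n : ℝ) + 1) ^ (α - 1) := by
  induction n with
  | zero => simp [cqWeight_zero]
  | succ n ih =>
    rw [cqWeight_succ]
    have hn : (0 : ℝ) < (n : ℝ) + 1 := by positivity
    have hn1 : (0 : ℝ) ≤ 1 / ((n : ℝ) + 1) := by positivity
    have hα : 0 < 1 - α := by linarith
    have hb : (1 + 1 / ((n : ℝ) + 1)) ^ (1 - α) ≤ 1 + (1 - α) * (1 / ((n : ℝ) + 1)) :=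
      rpow_one_add_le_one_add_mul_self (by linarith) hα.le (by linarith)
    have hr : ((n : ℝ) - -α) / (n + 1) ≤ (1 + 1 / ((n : ℝ) + 1)) ^ (α - 1) := by
      rw [show α - 1 = -(1 - α) by ring, Real.rpow_neg (by positivity), le_inv_comm₀]
      · refine hb.trans ?_
        rw [le_inv_comm₀]
        · rw [inv_eq_one_div, le_div_iff₀ (by positivity)]
          field_simp
          nlinarith [sq_nonneg (1 - α)]
        · positivity
        · rw [sub_neg_eq_add]; positivity
      · rw [sub_neg_eq_add]; positivity
      · positivity
    calc cqWeight (-α) n * (((n : ℝ) - -α) / (n + 1))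
        ≤ ((n : ℝ) + 1) ^ (α - 1) * (1 + 1 / ((n : ℝ) + 1)) ^ (α - 1) := by
          refine mul_le_mul ih hr ?_ (by positivity)
          rw [sub_neg_eq_add]; positivity
      _ = _ := by
          rw [← Real.mul_rpow (by positivity) (by positivity)]
          congr 1
          push_cast
          field_simp

lemma sum_rpow_neg_le {s : ℝ} (hs0 : 0 < s) (hs1 : s < 1) (n : ℕ) :
    ∑ m ∈ Finset.range n, ((m : ℝ) + 1) ^ (-s) ≤ (n : ℝ) ^ (1 - s) / (1 - s) := by
  have hs : 0 < 1 - s := by linarith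
  induction n with
  | zero => simp [Real.zero_rpow hs.ne']
  | succ n ih =>
    rw [Finset.sum_range_succ]
    have hn : (0 : ℝ) < (n : ℝ) + 1 := by positivity
    have hb : (1 + -(1 / ((n : ℝ) + 1))) ^ (1 - s) ≤ 1 + (1 - s) * (-(1 / ((n : ℝ) + 1))) :=
      rpow_one_add_le_one_add_mul_self
        (by rw [neg_le_neg_iff, div_le_one hn]; linarith) hs.le (by linarith)
    have he : 1 + -(1 / ((n : ℝ) + 1)) = n / (n + 1) := by field_simp; ring
    rw [he, Real.div_rpow (by positivity) hn.le, div_le_iff₀ (by positivity)] at hb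
    have hm : ((n : ℝ) + 1) ^ (1 - s) * (1 / ((n : ℝ) + 1)) = ((n : ℝ) + 1) ^ (-s) := by
      rw [mul_one_div, ← Real.rpow_sub_one hn.ne']
      congr 1
      ring
    rw [le_div_iff₀ hs] at ih ⊢
    push_cast
    nlinarith

/-- **Kaluza's theorem**: the reciprocal of a power series with positive log-convex coefficients
has nonpositive coefficients beyond the constant one. -/
lemma kaluza {w d : ℕ → ℝ} (hw : ∀ n, 0 < w n)
    (hlc : ∀ n, w (n + 1) ^ 2 ≤ w n * w (n + 2))
    (hd : PowerSeries.mk d * PowerSeries.mk w = 1) (n : ℕ) : d (n + 1) ≤ 0 := by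
  have hcoef : ∀ n, ∑ j ∈ Finset.range (n + 1), d j * w (n - j) = if n = 0 then 1 else 0 := by
    intro n
    have := congrArg (PowerSeries.coeff n) hd
    rw [PowerSeries.coeff_mul, Finset.Nat.sum_antidiagonal_eq_sum_range_succ_mk,
      PowerSeries.coeff_one] at this
    simpa using this
  have hmono : Monotone fun n => w (n + 1) / w n := by
    refine monotone_nat_of_le_succ fun n => ?_
    rw [div_le_div_iff₀ (hw _) (hw _)]
    nlinarith [hlc n]
  have hd0 : 0 < d 0 := by
    have := hcoef 0
    simp only [zero_add, Finset.range_one, Finset.sum_singleton, if_true] at this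
    by_contra! h
    nlinarith [hw 0]
  induction n using Nat.strong_induction_on with
  | _ n ih =>
    have h1 := hcoef (n + 1)
    rw [Finset.sum_range_succ, if_neg n.succ_ne_zero, Nat.sub_self] at h1
    suffices h : 0 ≤ ∑ j ∈ Finset.range (n + 1), d j * w (n + 1 - j) by
      by_contra! hc
      nlinarith [hw 0, mul_pos hc (hw 0)]
    have h2 := hcoef n
    have key : w (n + 1) / w n * ∑ j ∈ Finset.range (n + 1), d j * w (n - j) ≤
        ∑ j ∈ Finset.range (n + 1), d j * w (n + 1 - j) := by
      rw [Finset.mul_sum]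
      refine Finset.sum_le_sum fun j hj => ?_
      have hjn : j ≤ n := Nat.lt_succ_iff.mp (Finset.mem_range.mp hj)
      rcases Nat.eq_zero_or_pos j with rfl | hjpos
      · have := (hw n).ne'
        simp only [Nat.sub_zero]
        field_simp
        exact le_rfl
      · obtain ⟨i, rfl⟩ : ∃ i, j = i + 1 := ⟨j - 1, by omega⟩
        have hdi := ih i (by omega)
        have hm := hmono (show n - (i + 1) ≤ n by omega)
        simp only at hm
        rw [show n - (i + 1) + 1 = n + 1 - (i + 1) by omega, div_le_iff₀ (hw _)] at hm
        nlinarith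
    refine le_trans ?_ key
    rw [h2]
    have := div_pos (hw (n + 1)) (hw n)
    split_ifs <;> simp [this.le]

/-- The resolvent kernel with generating function `μ / ((1 - ξ) ^ α + μ)`. -/
lemma exists_resolvent_kernel {α : ℝ} (h0 : 0 < α) (h1 : α < 1) {μ : ℝ} (hμ : 0 < μ) :
    ∃ k : ℕ → ℝ, (∀ n, 0 ≤ k n) ∧ Antitone k ∧
      (∀ n, ∑ j ∈ Finset.range n, k j ≤ 1) ∧
      (∀ n, k n ≤ μ * cqWeight (-α) n) ∧
      PowerSeries.mk k * (cqSeries α + PowerSeries.C μ) = PowerSeries.C μ := by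
  have hβ : 0 < 1 - α := by linarith
  have hβ1 : 1 - α ≤ 1 := by linarith
  set a := cqWeight (-(1 - α)) with ha
  have hapos : ∀ n, 0 < a n := cqWeight_neg_pos hβ
  set w : ℕ → ℝ := fun n => 1 + μ⁻¹ * a n with hwdef
  have hμi : 0 < μ⁻¹ := inv_pos.mpr hμ
  have hwpos : ∀ n, 0 < w n := fun n => by have := hapos n; positivity
  have hlc : ∀ n, w (n + 1) ^ 2 ≤ w n * w (n + 2) := by
    intro n
    have h := cqWeight_neg_log_convex hβ hβ1 n
    rw [← ha] at h
    have h2 : 2 * a (n + 1) ≤ a n + a (n + 2) := by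
      refine le_of_sq_le_sq ?_ (by linarith [hapos n, hapos (n + 2)])
      nlinarith [sq_nonneg (a n - a (n + 2))]
    simp only [hwdef]
    nlinarith [mul_le_mul_of_nonneg_left h2 hμi.le,
      mul_le_mul_of_nonneg_left h (mul_pos hμi hμi).le]
  have hwanti : Antitone w := by
    refine antitone_nat_of_succ_le fun n => ?_
    have := cqWeight_neg_succ_le hβ hβ1 n
    simp only [hwdef]
    gcongr
  have hWeq : PowerSeries.mk w = cqSeries (-1) + PowerSeries.C μ⁻¹ * cqSeries (-(1 - α)) := by
    ext n
    simp [hwdef, cqSeries, cqWeight_neg_one, ha]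
  have hWinv : PowerSeries.mk (fun n => PowerSeries.coeff n (PowerSeries.mk w)⁻¹) *
      PowerSeries.mk w = 1 := by
    have : PowerSeries.mk (fun n => PowerSeries.coeff n (PowerSeries.mk w)⁻¹) =
      (PowerSeries.mk w)⁻¹ := by ext n; simp
    rw [this]
    apply PowerSeries.inv_mul_cancel
    rw [← PowerSeries.coeff_zero_eq_constantCoeff_apply, PowerSeries.coeff_mk]
    exact (hwpos 0).ne'
  set d : ℕ → ℝ := fun n => PowerSeries.coeff n (PowerSeries.mk w)⁻¹ with hd
  have hdneg := kaluza hwpos hlc hWinv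
  set k : ℕ → ℝ := fun n => ∑ j ∈ Finset.range (n + 1), d j with hk
  have hK : PowerSeries.mk k = PowerSeries.mk d * cqSeries (-1) := by
    ext n
    rw [PowerSeries.coeff_mul, Finset.Nat.sum_antidiagonal_eq_sum_range_succ_mk]
    simp [hk, cqSeries, cqWeight_neg_one]
  have hKW : PowerSeries.mk k * PowerSeries.mk w = cqSeries (-1) := by
    rw [hK, mul_right_comm, hWinv, one_mul]
  have hfull : PowerSeries.mk k * (cqSeries α + PowerSeries.C μ) = PowerSeries.C μ := by
    have e1 : cqSeries (-1) * cqSeries 1 = 1 := by rw [← cqSeries_add]; simp [cqSeries_zero]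
    have e2 : cqSeries (-(1 - α)) * cqSeries 1 = cqSeries α := by
      rw [← cqSeries_add]; congr 1; ring
    have e3 : PowerSeries.C μ * PowerSeries.C μ⁻¹ = (1 : PowerSeries ℝ) := by
      rw [← map_mul, mul_inv_cancel₀ hμ.ne', map_one]
    have e4 : cqSeries α + PowerSeries.C μ =
        PowerSeries.mk w * (PowerSeries.C μ * cqSeries 1) := by
      rw [hWeq]
      linear_combination -PowerSeries.C μ * e1 - e2 - cqSeries (-(1 - α)) * cqSeries 1 * e3
    rw [e4, ← mul_assoc, hKW]
    linear_combination PowerSeries.C μ * e1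
  have hkanti : Antitone k := by
    refine antitone_nat_of_succ_le fun n => ?_
    simp only [hk]
    rw [Finset.sum_range_succ _ (n + 1)]
    linarith [hdneg n]
  have hknn : ∀ n, 0 ≤ k n := by
    intro n
    rcases Nat.eq_zero_or_pos n with rfl | hn
    · have := congrArg (PowerSeries.coeff 0) hKW
      rw [PowerSeries.coeff_mul, Finset.Nat.sum_antidiagonal_eq_sum_range_succ_mk] at this
      simp only [Finset.range_one, Finset.sum_singleton, PowerSeries.coeff_mk,
        cqSeries, cqWeight_zero, Nat.sub_zero] at this
      by_contra! h
      nlinarith [hwpos 0]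
    · have h := congrArg (PowerSeries.coeff n) hWinv
      rw [PowerSeries.coeff_mul, Finset.Nat.sum_antidiagonal_eq_sum_range_succ_mk,
        PowerSeries.coeff_one, if_neg hn.ne'] at h
      simp only [PowerSeries.coeff_mk] at h
      have h3 : 0 ≤ w n * k n := by
        rw [← h]
        simp only [hk]
        rw [Finset.mul_sum]
        refine Finset.sum_le_sum fun j hj => ?_
        rcases Nat.eq_zero_or_pos j with rfl | hjpos
        · rw [Nat.sub_zero, mul_comm]
        · obtain ⟨i, rfl⟩ : ∃ i, j = i + 1 := ⟨j - 1, by omega⟩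
          have := hwanti (Nat.sub_le n (i + 1))
          nlinarith [hdneg i]
      exact nonneg_of_mul_nonneg_right h3 (hwpos n)
  refine ⟨k, hknn, hkanti, ?_, ?_, hfull⟩
  · intro n
    have h := congrArg (PowerSeries.coeff n) hKW
    rw [PowerSeries.coeff_mul, Finset.Nat.sum_antidiagonal_eq_sum_range_succ_mk] at h
    simp only [PowerSeries.coeff_mk, cqSeries, cqWeight_neg_one] at h
    rw [← h]
    refine (Finset.sum_le_sum_of_subset_of_nonneg
      (Finset.range_subset_range.mpr n.le_succ) fun i _ _ => hknn i).trans ?_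
    refine Finset.sum_le_sum fun j _ => ?_
    have : 0 ≤ μ⁻¹ * a (n - j) := (mul_pos hμi (hapos _)).le
    simp only [hwdef]
    nlinarith [hknn j]
  · intro n
    have e1 : cqSeries α * cqSeries (-α) = 1 := by rw [← cqSeries_add]; simp [cqSeries_zero]
    have e2 : PowerSeries.mk k + PowerSeries.C μ * (PowerSeries.mk k * cqSeries (-α)) =
        PowerSeries.C μ * cqSeries (-α) := by
      linear_combination cqSeries (-α) * hfull - PowerSeries.mk k * e1
    have h := congrArg (PowerSeries.coeff n) e2
    rw [map_add, PowerSeries.coeff_C_mul, PowerSeries.coeff_C_mul, PowerSeries.coeff_mul] at h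
    simp only [PowerSeries.coeff_mk, cqSeries] at h
    rw [← h]
    have : 0 ≤ ∑ x ∈ Finset.HasAntidiagonal.antidiagonal n, k x.1 * cqWeight (-α) x.2 :=
      Finset.sum_nonneg fun x _ => mul_nonneg (hknn _) (cqWeight_neg_pos h0 _).le
    nlinarith

/-- Solutions of the scalar scheme are convolutions with the resolvent kernel. -/
lemma eq_resolvent_convolution {α μ : ℝ} (hμ : 0 < μ) {k : ℕ → ℝ}
    (hk : PowerSeries.mk k * (cqSeries α + PowerSeries.C μ) = PowerSeries.C μ)
    {N : ℕ} {u g : ℕ → ℂ} (hu0 : u 0 = 0) (hg0 : g 0 = 0)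
    (h : ∀ n, 1 ≤ n → n ≤ N →
      ∑ j ∈ Finset.range (n + 1), (cqWeight α j : ℂ) * u (n - j) + μ * u n = μ * g n)
    {n : ℕ} (hn : n ≤ N) :
    u n = ∑ j ∈ Finset.range (n + 1), (k (n - j) : ℂ) * g j := by
  have hμ' : (μ : ℂ) ≠ 0 := by exact_mod_cast hμ.ne'
  set G : ℕ → ℂ := fun n =>
    (μ : ℂ)⁻¹ * (∑ j ∈ Finset.range (n + 1), (cqWeight α j : ℂ) * u (n - j) + μ * u n) with hG
  have hGg : ∀ n ≤ N, G n = g n := by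
    intro n hn
    rcases Nat.eq_zero_or_pos n with rfl | hpos
    · simp [hG, hu0, hg0]
    · simp only [hG]
      rw [h n hpos hn, inv_mul_cancel_left₀ hμ']
  have e1 : (PowerSeries.map Complex.ofRealHom (cqSeries α) + PowerSeries.C (μ : ℂ)) *
      PowerSeries.mk u = PowerSeries.C (μ : ℂ) * PowerSeries.mk G := by
    ext n
    rw [add_mul, map_add, PowerSeries.coeff_C_mul, PowerSeries.coeff_C_mul,
      PowerSeries.coeff_mul, Finset.Nat.sum_antidiagonal_eq_sum_range_succ_mk]
    simp only [PowerSeries.coeff_mk, PowerSeries.coeff_map, cqSeries, hG,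
      Complex.ofRealHom_eq_coe]
    rw [mul_inv_cancel_left₀ hμ']
  have e2 := congrArg (PowerSeries.map Complex.ofRealHom) hk
  simp only [map_mul, map_add, PowerSeries.map_C, Complex.ofRealHom_eq_coe] at e2
  have e3 : PowerSeries.C (μ : ℂ) * PowerSeries.mk u = PowerSeries.C (μ : ℂ) *
      (PowerSeries.mk G * PowerSeries.map Complex.ofRealHom (PowerSeries.mk k)) := by
    linear_combination PowerSeries.map Complex.ofRealHom (PowerSeries.mk k) * e1 -
      PowerSeries.mk u * e2
  have e4 := congrArg (PowerSeries.coeff n) e3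
  rw [PowerSeries.coeff_C_mul, PowerSeries.coeff_C_mul, PowerSeries.coeff_mul,
    Finset.Nat.sum_antidiagonal_eq_sum_range_succ_mk] at e4
  have e5 := mul_left_cancel₀ hμ' e4
  simp only [PowerSeries.coeff_mk, PowerSeries.coeff_map, Complex.ofRealHom_eq_coe] at e5
  rw [e5]
  refine Finset.sum_congr rfl fun j hj => ?_
  rw [hGg j ((Nat.lt_succ_iff.mp (Finset.mem_range.mp hj)).trans hn), mul_comm]

/-- A one-sided maximal function of a finite sequence. -/
lemma exists_maximal (N : ℕ) (h : ℕ → ℝ) :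
    ∃ M : ℕ → ℝ, ∀ j < N,
      (∀ m, j < m → m ≤ N → ∑ i ∈ Finset.Ico j m, (h i - M j) ≤ 0) ∧
      ∃ m, j < m ∧ m ≤ N ∧ ∑ i ∈ Finset.Ico j m, (h i - M j) = 0 := by
  have key : ∀ j : ℕ, ∃ x : ℝ, j < N →
      (∀ m, j < m → m ≤ N → ∑ i ∈ Finset.Ico j m, (h i - x) ≤ 0) ∧
      ∃ m, j < m ∧ m ≤ N ∧ ∑ i ∈ Finset.Ico j m, (h i - x) = 0 := by
    intro j
    by_cases hj : j < N
    · obtain ⟨m, hm, hmax⟩ := Finset.exists_max_image (Finset.Ioc j N)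
        (fun m => (∑ i ∈ Finset.Ico j m, h i) / ((m : ℝ) - j))
        ⟨N, Finset.mem_Ioc.mpr ⟨hj, le_rfl⟩⟩
      have hsum : ∀ (x : ℝ) (l : ℕ), j < l → ∑ i ∈ Finset.Ico j l, (h i - x) =
          ∑ i ∈ Finset.Ico j l, h i - x * ((l : ℝ) - j) := by
        intro x l hl
        rw [Finset.sum_sub_distrib, Finset.sum_const, Nat.card_Ico, nsmul_eq_mul,
          Nat.cast_sub hl.le, mul_comm]
      have hpos : ∀ l : ℕ, j < l → (0 : ℝ) < (l : ℝ) - j := fun l hl => by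
        rw [sub_pos]; exact_mod_cast hl
      rw [Finset.mem_Ioc] at hm
      refine ⟨(∑ i ∈ Finset.Ico j m, h i) / ((m : ℝ) - j), fun _ => ⟨?_, m, hm.1, hm.2, ?_⟩⟩
      · intro l hl hlN
        have := hmax l (Finset.mem_Ioc.mpr ⟨hl, hlN⟩)
        rw [div_le_iff₀ (hpos l hl)] at this
        rw [hsum _ l hl]
        linarith
      · rw [hsum _ m hm.1, div_mul_cancel₀ _ (hpos m hm.1).ne', sub_self]
    · exact ⟨0, fun hj' => absurd hj' hj⟩
  choose M hM using key
  exact ⟨M, hM⟩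

/-- The weak-type inequality for the one-sided maximal function. -/
lemma maximal_weak_type {N : ℕ} {h M : ℕ → ℝ}
    (hM : ∀ j < N, (∀ m, j < m → m ≤ N → ∑ i ∈ Finset.Ico j m, (h i - M j) ≤ 0) ∧
      ∃ m, j < m ∧ m ≤ N ∧ ∑ i ∈ Finset.Ico j m, (h i - M j) = 0) (x : ℝ) :
    0 ≤ ∑ j ∈ Finset.range N, if x < M j then h j - x else 0 := by
  have hlt : ∀ j m, j < m → m ≤ N → 0 < ∑ i ∈ Finset.Ico j m, (h i - x) → x < M j := by
    intro j m hjm hmN hpos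
    by_contra! hle
    have h1 := (hM j (by omega)).1 m hjm hmN
    have h2 : ∑ i ∈ Finset.Ico j m, (h i - x) ≤ ∑ i ∈ Finset.Ico j m, (h i - M j) :=
      Finset.sum_le_sum fun i _ => by linarith
    linarith
  suffices H : ∀ l s, N - s = l → s ≤ N →
      0 ≤ ∑ j ∈ Finset.Ico s N, if x < M j then h j - x else 0 by
    simpa using H N 0 (by simp) (Nat.zero_le N)
  intro l
  induction l using Nat.strong_induction_on with
  | _ l ih =>
    intro s hl hs
    rcases hs.eq_or_lt with rfl | hsN
    · simp
    by_cases hx : x < M s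
    · have hex : ∃ m, s < m ∧ m ≤ N ∧ 0 < ∑ i ∈ Finset.Ico s m, (h i - x) := by
        obtain ⟨m, h1, h2, h3⟩ := (hM s hsN).2
        refine ⟨m, h1, h2, h3 ▸ Finset.sum_lt_sum_of_nonempty ?_ fun i _ => by linarith⟩
        exact Finset.nonempty_Ico.mpr h1
      classical
      obtain ⟨hsm, hmN, hpos⟩ := Nat.find_spec hex
      set m := Nat.find hex with hm
      have hmem : ∀ j ∈ Finset.Ico s m, x < M j := by
        intro j hj
        rw [Finset.mem_Ico] at hj
        refine hlt j m hj.2 hmN ?_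
        rcases hj.1.eq_or_lt with rfl | hsj
        · exact hpos
        · have hmin := Nat.find_min hex hj.2
          have hle : ∑ i ∈ Finset.Ico s j, (h i - x) ≤ 0 := by
            by_contra! hc
            exact hmin ⟨hsj, by omega, hc⟩
          have := Finset.sum_Ico_consecutive (fun i => h i - x) hj.1 hj.2.le
          linarith
      rw [← Finset.sum_Ico_consecutive _ hsm.le hmN]
      refine add_nonneg ?_ (ih (N - m) (by omega) m rfl hmN)
      rw [Finset.sum_congr rfl fun j hj => if_pos (hmem j hj)]
      exact hpos.le
    · rw [Finset.sum_eq_sum_Ico_succ_bot hsN, if_neg hx, zero_add]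
      exact ih (N - (s + 1)) (by omega) (s + 1) rfl hsN

/-- The strong-type `ℓ^p` inequality for the one-sided maximal function. -/
lemma maximal_strong_type {N : ℕ} {h M : ℕ → ℝ} (hh : ∀ j, 0 ≤ h j)
    (hM : ∀ j < N, (∀ m, j < m → m ≤ N → ∑ i ∈ Finset.Ico j m, (h i - M j) ≤ 0) ∧
      ∃ m, j < m ∧ m ≤ N ∧ ∑ i ∈ Finset.Ico j m, (h i - M j) = 0)
    {p r : ℝ} (hpr : p.HolderConjugate r) :
    ∑ j ∈ Finset.range N, M j ^ p ≤ r ^ p * ∑ j ∈ Finset.range N, h j ^ p := by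
  have hp1 : 1 < p := hpr.lt
  have hp0 : 0 < p := hpr.pos
  have hr0 : 0 < r := hpr.symm.pos
  have hM0 : ∀ j < N, 0 ≤ M j := by
    intro j hj
    have := (hM j hj).1 (j + 1) j.lt_succ_self hj
    simp only [Nat.Ico_succ_singleton, Finset.sum_singleton] at this
    linarith [hh j]
  set F : ℕ → ℝ → ℝ := fun j =>
    (Set.Ioc 0 (M j)).indicator fun x => x ^ (p - 2) * (h j - x) with hF
  have hint : ∀ j < N, IntervalIntegrable (fun x : ℝ => h j * x ^ (p - 2) - x ^ (p - 1))
      MeasureTheory.volume 0 (M j) := fun j _ =>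
    ((intervalIntegral.intervalIntegrable_rpow' (by linarith)).const_mul _).sub
      (intervalIntegral.intervalIntegrable_rpow' (by linarith))
  have hcongr : ∀ j, Set.EqOn (fun x : ℝ => h j * x ^ (p - 2) - x ^ (p - 1))
      (fun x => x ^ (p - 2) * (h j - x)) (Set.Ioc 0 (M j)) := by
    intro j x hx
    have : x ^ (p - 1) = x ^ (p - 2) * x := by
      rw [← Real.rpow_add_one hx.1.ne']
      congr 1
      ring
    simp only [this]
    ring
  have hFint : ∀ j < N, MeasureTheory.Integrable (F j) := fun j hj =>
    (MeasureTheory.integrable_indicator_iff measurableSet_Ioc).mpr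
      (((intervalIntegrable_iff_integrableOn_Ioc_of_le (hM0 j hj)).mp (hint j hj)).congr_fun
        (hcongr j) measurableSet_Ioc)
  have hFval : ∀ j < N, ∫ x, F j x = h j * (M j ^ (p - 1) / (p - 1)) - M j ^ p / p := by
    intro j hj
    rw [MeasureTheory.integral_indicator measurableSet_Ioc,
      ← MeasureTheory.setIntegral_congr_fun measurableSet_Ioc (hcongr j),
      ← intervalIntegral.integral_of_le (hM0 j hj), intervalIntegral.integral_sub
        ((intervalIntegral.intervalIntegrable_rpow' (by linarith)).const_mul _)
        (intervalIntegral.intervalIntegrable_rpow' (by linarith)),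
      intervalIntegral.integral_const_mul, integral_rpow (Or.inl (by linarith)),
      integral_rpow (Or.inl (by linarith)), show p - 2 + 1 = p - 1 by ring,
      show p - 1 + 1 = p by ring, Real.zero_rpow (by linarith), Real.zero_rpow (by linarith),
      sub_zero, sub_zero]
  have hnn : 0 ≤ ∑ j ∈ Finset.range N, (h j * (M j ^ (p - 1) / (p - 1)) - M j ^ p / p) := by
    rw [← Finset.sum_congr rfl fun j hj => hFval j (Finset.mem_range.mp hj),
      ← MeasureTheory.integral_finsetSum _ fun j hj => hFint j (Finset.mem_range.mp hj)]
    refine MeasureTheory.integral_nonneg_of_ae ?_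
    have hae : ∀ᵐ x : ℝ, x ∉ M '' (Finset.range N : Set ℕ) :=
      ((Finset.finite_toSet _).image M).countable.ae_notMem _
    filter_upwards [hae] with x hx
    simp only [Pi.zero_apply, hF]
    by_cases hx0 : 0 < x
    · have hw := mul_nonneg (Real.rpow_nonneg hx0.le (p - 2)) (maximal_weak_type hM x)
      rw [Finset.mul_sum] at hw
      refine hw.trans_eq (Finset.sum_congr rfl fun j hj => ?_)
      have hne : x ≠ M j := fun hxe => hx ⟨j, hj, hxe.symm⟩
      by_cases hxM : x < M j
      · rw [if_pos hxM, Set.indicator_of_mem (Set.mem_Ioc.mpr ⟨hx0, hxM.le⟩)]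
      · rw [if_neg hxM, Set.indicator_of_notMem
          (fun hm => hxM (lt_of_le_of_ne (Set.mem_Ioc.mp hm).2 hne)), mul_zero]
    · exact Finset.sum_nonneg fun j _ => by
        rw [Set.indicator_of_notMem (fun hm => hx0 (Set.mem_Ioc.mp hm).1)]
  have hyoung : ∀ j ∈ Finset.range N, h j * (M j ^ (p - 1) / (p - 1)) - M j ^ p / p ≤
      (r ^ p * h j ^ p / p - M j ^ p / p) / p := by
    intro j hj
    have hMj := hM0 j (Finset.mem_range.mp hj)
    have hy := Real.young_inequality_of_nonneg (mul_nonneg hr0.le (hh j))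
      (Real.rpow_nonneg hMj (p - 1)) hpr
    rw [Real.mul_rpow hr0.le (hh j), ← Real.rpow_mul hMj, hpr.sub_one_mul_conj] at hy
    have hrp : r = p / (p - 1) := hpr.conjugate_eq
    have e1 : h j * (M j ^ (p - 1) / (p - 1)) = r * h j * M j ^ (p - 1) / p := by
      have : p - 1 ≠ 0 := by linarith
      rw [hrp]
      field_simp
    have e2 : M j ^ p / r = M j ^ p - M j ^ p / p := by
      have := hpr.inv_add_inv_eq_one
      rw [div_eq_mul_inv, div_eq_mul_inv]
      linear_combination M j ^ p * this
    rw [e1, ← sub_nonneg]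
    have : 0 ≤ (r ^ p * h j ^ p / p + M j ^ p / r - r * h j * M j ^ (p - 1)) / p :=
      div_nonneg (by linarith) hp0.le
    rw [e2] at this
    refine this.trans_eq ?_
    ring
  have hfin := hnn.trans (Finset.sum_le_sum hyoung)
  rw [← Finset.sum_div, Finset.sum_sub_distrib, ← Finset.sum_div, ← Finset.sum_div,
    ← Finset.mul_sum, ← sub_div, div_div] at hfin
  have := (div_nonneg_iff.mp hfin).resolve_right (fun hc => absurd hc.2 (by
    have : 0 < p * p := by positivity
    linarith))
  linarith [this.1]

/-- Averages against a decreasing kernel of mass at most one are dominated by the maximal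
function. -/
lemma kernel_average_le {k y : ℕ → ℝ} {M : ℝ} {L : ℕ} (hM : 0 ≤ M) (hk : ∀ n, 0 ≤ k n)
    (hanti : Antitone k) (hsum : ∀ n, ∑ j ∈ Finset.range n, k j ≤ 1)
    (hy : ∀ m ≤ L, ∑ i ∈ Finset.range m, (y i - M) ≤ 0) :
    ∑ i ∈ Finset.range L, k i * y i ≤ M := by
  have key : ∀ m ≤ L, ∑ i ∈ Finset.range m, k i * (y i - M) ≤
      k m * ∑ i ∈ Finset.range m, (y i - M) := by
    intro m
    induction m with
    | zero => simp
    | succ m ih =>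
      intro hm
      have h1 := ih (by omega)
      have h2 := mul_le_mul_of_nonpos_right (hanti m.le_succ) (hy (m + 1) hm)
      refine le_trans ?_ h2
      rw [Finset.sum_range_succ, Finset.sum_range_succ, mul_add]
      linarith
  have h1 := (key L le_rfl).trans (mul_nonpos_of_nonneg_of_nonpos (hk L) (hy L le_rfl))
  have h2 : ∑ i ∈ Finset.range L, k i * (y i - M) =
      ∑ i ∈ Finset.range L, k i * y i - (∑ i ∈ Finset.range L, k i) * M := by
    rw [Finset.sum_mul, ← Finset.sum_sub_distrib]
    exact Finset.sum_congr rfl fun i _ => by ring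
  nlinarith [hsum L]

/-- An `ℓ^r` bound, uniform in the kernels, for a sum of convolutions with decreasing kernels
of mass at most one. -/
lemma sum_convolution_rpow_le {ι : Type*} [Fintype ι] {k a : ι → ℕ → ℝ}
    (hk : ∀ i n, 0 ≤ k i n) (hanti : ∀ i, Antitone (k i))
    (hsum : ∀ i n, ∑ j ∈ Finset.range n, k i j ≤ 1) (ha : ∀ i n, 0 ≤ a i n)
    {r : ℝ} (hr : 1 < r) (N : ℕ) :
    ∑ n ∈ Finset.range N, (∑ i, ∑ j ∈ Finset.range (n + 1), k i (n - j) * a i j) ^ r ≤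
      r ^ r * ∑ n ∈ Finset.range N, (∑ i, a i n) ^ r := by
  set S : ℕ → ℝ := fun n => ∑ i, ∑ j ∈ Finset.range (n + 1), k i (n - j) * a i j with hS
  have hS0 : ∀ n, 0 ≤ S n := fun n => Finset.sum_nonneg fun i _ => Finset.sum_nonneg fun j _ =>
    mul_nonneg (hk _ _) (ha _ _)
  have hpr : (r.conjExponent).HolderConjugate r := (Real.HolderConjugate.conjExponent hr).symm
  set p := r.conjExponent
  have hr0 : 0 < r := by linarith
  have hp0 : 0 < p := hpr.pos
  set h : ℕ → ℝ := fun n => S n ^ (r - 1) with hh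
  have hh0 : ∀ n, 0 ≤ h n := fun n => Real.rpow_nonneg (hS0 n) _
  have hhp : ∀ n, h n ^ p = S n ^ r := fun n => by
    simp only [hh]
    rw [← Real.rpow_mul (hS0 n), hpr.symm.sub_one_mul_conj]
  have hhS : ∀ n, h n * S n = S n ^ r := fun n => by
    simp only [hh]
    rw [← Real.rpow_add_one' (hS0 n) (by linarith), sub_add_cancel]
  obtain ⟨M, hM⟩ := exists_maximal N h
  have hM0 : ∀ j < N, 0 ≤ M j := by
    intro j hj
    have := (hM j hj).1 (j + 1) j.lt_succ_self hj
    simp only [Nat.Ico_succ_singleton, Finset.sum_singleton] at this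
    linarith [hh0 j]
  have hstrong := maximal_strong_type hh0 hM hpr
  simp only [hhp] at hstrong
  have hdual : ∑ n ∈ Finset.range N, S n ^ r ≤ ∑ j ∈ Finset.range N, (∑ i, a i j) * M j := by
    have e : ∑ n ∈ Finset.range N, S n ^ r = ∑ i, ∑ j ∈ Finset.range N,
        a i j * ∑ n ∈ Finset.range (N - j), k i n * h (j + n) := by
      simp_rw [← hhS, hS, Finset.mul_sum]
      rw [Finset.sum_comm]
      refine Finset.sum_congr rfl fun i _ => ?_
      rw [Finset.sum_sigma', Finset.sum_sigma']
      refine Finset.sum_bij' (fun x _ => ⟨x.2, x.1 - x.2⟩) (fun x _ => ⟨x.1 + x.2, x.1⟩)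
        ?_ ?_ ?_ ?_ ?_
      · rintro ⟨n, j⟩ hx
        simp only [Finset.mem_sigma, Finset.mem_range] at hx ⊢
        omega
      · rintro ⟨n, j⟩ hx
        simp only [Finset.mem_sigma, Finset.mem_range] at hx ⊢
        omega
      · rintro ⟨n, j⟩ hx
        simp only [Finset.mem_sigma, Finset.mem_range] at hx
        have : j + (n - j) = n := by omega
        simp [this]
      · rintro ⟨n, j⟩ hx
        simp
      · rintro ⟨n, j⟩ hx
        simp only [Finset.mem_sigma, Finset.mem_range] at hx
        have : j + (n - j) = n := by omega
        simp only [this]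
        ring
    rw [e, Finset.sum_comm]
    refine Finset.sum_le_sum fun j hj => ?_
    rw [Finset.sum_mul]
    have hjN := Finset.mem_range.mp hj
    refine Finset.sum_le_sum fun i _ => mul_le_mul_of_nonneg_left ?_ (ha i j)
    refine kernel_average_le (hM0 j hjN) (hk i) (hanti i) (hsum i) fun m hm => ?_
    rcases Nat.eq_zero_or_pos m with rfl | hmpos
    · simp
    · have := (hM j hjN).1 (j + m) (by omega) (by omega)
      rw [Finset.sum_Ico_eq_sum_range] at this
      simpa using this
  have hyoung : ∀ j ∈ Finset.range N, (∑ i, a i j) * M j ≤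
      r ^ r * (∑ i, a i j) ^ r / r + (r ^ p)⁻¹ * M j ^ p / p := by
    intro j hj
    have hMj := hM0 j (Finset.mem_range.mp hj)
    have haj : 0 ≤ ∑ i, a i j := Finset.sum_nonneg fun i _ => ha i j
    have hy := Real.young_inequality_of_nonneg (mul_nonneg hr0.le haj)
      (mul_nonneg (inv_nonneg.mpr hr0.le) hMj) hpr.symm
    rw [Real.mul_rpow hr0.le haj, Real.mul_rpow (inv_nonneg.mpr hr0.le) hMj,
      Real.inv_rpow hr0.le] at hy
    refine le_trans (le_of_eq ?_) hy
    field_simp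
  have hfin := hdual.trans (Finset.sum_le_sum hyoung)
  rw [Finset.sum_add_distrib, ← Finset.sum_div, ← Finset.sum_div, ← Finset.mul_sum,
    ← Finset.mul_sum] at hfin
  have hrp : 0 < r ^ p := Real.rpow_pos_of_pos hr0 p
  have h3 : (r ^ p)⁻¹ * ∑ j ∈ Finset.range N, M j ^ p ≤ ∑ n ∈ Finset.range N, S n ^ r := by
    rw [inv_mul_le_iff₀ hrp]
    exact hstrong
  have h4 := div_le_div_of_nonneg_right h3 hp0.le
  have h5 : (∑ n ∈ Finset.range N, S n ^ r) / p =
      ∑ n ∈ Finset.range N, S n ^ r - (∑ n ∈ Finset.range N, S n ^ r) / r := by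
    have := hpr.inv_add_inv_eq_one
    rw [div_eq_mul_inv, div_eq_mul_inv]
    linear_combination (∑ n ∈ Finset.range N, S n ^ r) * this
  have h6 : (∑ n ∈ Finset.range N, S n ^ r) / r ≤
      r ^ r * (∑ n ∈ Finset.range N, (∑ i, a i n) ^ r) / r := by linarith
  exact (div_le_div_iff_of_pos_right hr0).mp h6

section Spectral

variable {V : Type} [NormedAddCommGroup V] [InnerProductSpace ℂ V] [FiniteDimensional ℂ V]

lemma spectrum_subset_Ioi {A : V →L[ℂ] V} (hpos : ∀ x : V, x ≠ 0 → 0 < (⟪A x, x⟫).re) :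
    spectrum ℝ A ⊆ Set.Ioi 0 := by
  intro t ht
  by_contra hle
  rw [Set.mem_Ioi, not_lt] at hle
  refine ht ?_
  have hinj : Function.Injective (algebraMap ℝ (V →L[ℂ] V) t - A) := by
    rw [injective_iff_map_eq_zero]
    intro x hx
    by_contra hx0
    have h1 : A x = (t : ℂ) • x := by
      have : t • x - A x = 0 := by simpa [Algebra.algebraMap_eq_smul_one] using hx
      rw [Complex.coe_smul]
      exact (sub_eq_zero.mp this).symm
    have h2 := hpos x hx0
    rw [h1, inner_smul_left, inner_self_eq_norm_sq_to_K] at h2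
    simp only [Complex.conj_ofReal, Complex.coe_algebraMap, ← Complex.ofReal_pow,
      ← Complex.ofReal_mul, Complex.ofReal_re] at h2
    nlinarith [sq_nonneg ‖x‖]
  rw [spectrum.mem_resolventSet_iff, ContinuousLinearMap.isUnit_iff_bijective]
  exact ⟨hinj, LinearMap.injective_iff_surjective
    (f := ((algebraMap ℝ (V →L[ℂ] V) t - A : V →L[ℂ] V) : V →ₗ[ℂ] V)) |>.mp hinj⟩

lemma isSelfAdjoint_opRPow (A : V →L[ℂ] V) (β : ℝ) : IsSelfAdjoint (opRPow A β) :=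
  cfc_predicate _ _

lemma opRPow_mul_opRPow {A : V →L[ℂ] V} (hpos : ∀ x : V, x ≠ 0 → 0 < (⟪A x, x⟫).re)
    (β γ : ℝ) : opRPow A β * opRPow A γ = opRPow A (β + γ) := by
  have hsp := spectrum_subset_Ioi hpos
  have hc : ∀ δ : ℝ, ContinuousOn (fun x : ℝ => x ^ δ) (spectrum ℝ A) := fun δ =>
    continuousOn_id.rpow_const fun x hx => Or.inl (hsp hx).ne'
  rw [opRPow, opRPow, opRPow, ← cfc_mul _ _ A (hc β) (hc γ)]
  exact cfc_congr fun x hx => (Real.rpow_add (hsp hx) β γ).symm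

lemma opRPow_one {A : V →L[ℂ] V} (hA : IsSelfAdjoint A) : opRPow A 1 = A := by
  simp only [opRPow, Real.rpow_one]
  exact cfc_id' ℝ A

lemma opRPow_zero {A : V →L[ℂ] V} (hA : IsSelfAdjoint A) : opRPow A 0 = 1 := by
  simp only [opRPow, Real.rpow_zero]
  exact cfc_const_one ℝ A

lemma norm_opRPow_sq {A : V →L[ℂ] V} (hpos : ∀ x : V, x ≠ 0 → 0 < (⟪A x, x⟫).re)
    {ι : Type*} [Fintype ι] (e : OrthonormalBasis ι ℂ V) {β : ℝ} {c : ι → ℝ}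
    (hc : ∀ i, opRPow A (β + β) (e i) = (c i : ℂ) • e i) (v : V) :
    ‖opRPow A β v‖ ^ 2 = ∑ i, c i * ‖⟪e i, v⟫‖ ^ 2 := by
  have hsym : ∀ (γ : ℝ) (x y : V), ⟪opRPow A γ x, y⟫ = ⟪x, opRPow A γ y⟫ := fun γ x y =>
    (ContinuousLinearMap.isSelfAdjoint_iff_isSymmetric.mp (isSelfAdjoint_opRPow A γ)) x y
  have h1 : ((‖opRPow A β v‖ ^ 2 : ℝ) : ℂ) = ((∑ i, c i * ‖⟪e i, v⟫‖ ^ 2 : ℝ) : ℂ) := by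
    have h2 : ((‖opRPow A β v‖ ^ 2 : ℝ) : ℂ) = ⟪v, opRPow A (β + β) v⟫ := by
      rw [← opRPow_mul_opRPow hpos, mul_apply_eq_comp, ← hsym,
        inner_self_eq_norm_sq_to_K]
      simp
    rw [h2, ← e.sum_inner_mul_inner]
    push_cast
    refine Finset.sum_congr rfl fun i _ => ?_
    rw [← hsym, hc, inner_smul_left, Complex.conj_ofReal, ← inner_conj_symm v (e i)]
    rw [mul_left_comm, ← Complex.conj_mul']
  exact_mod_cast h1

/-- Diagonalization of a positive definite operator together with the powers `A ^ (± 1 / 2)`. -/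
lemma exists_diagonalization {A : V →L[ℂ] V} (hA : IsSelfAdjoint A)
    (hpos : ∀ x : V, x ≠ 0 → 0 < (⟪A x, x⟫).re) :
    ∃ (e : OrthonormalBasis (Fin (Module.finrank ℂ V)) ℂ V)
      (l : Fin (Module.finrank ℂ V) → ℝ), (∀ i, 0 < l i) ∧
      (∀ i v, ⟪e i, A v⟫ = l i * ⟪e i, v⟫) ∧
      (∀ v, ‖v‖ ^ 2 = ∑ i, ‖⟪e i, v⟫‖ ^ 2) ∧
      (∀ v, ‖opRPow A (1 / 2) v‖ ^ 2 = ∑ i, l i * ‖⟪e i, v⟫‖ ^ 2) ∧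
      (∀ v, ‖opRPow A (-(1 / 2)) v‖ ^ 2 = ∑ i, (l i)⁻¹ * ‖⟪e i, v⟫‖ ^ 2) := by
  have hsym : (A : V →ₗ[ℂ] V).IsSymmetric :=
    ContinuousLinearMap.isSelfAdjoint_iff_isSymmetric.mp hA
  set e := hsym.eigenvectorBasis rfl
  set l := hsym.eigenvalues rfl
  have hAe : ∀ i, A (e i) = (l i : ℂ) • e i := fun i => hsym.apply_eigenvectorBasis rfl i
  have hl : ∀ i, 0 < l i := by
    intro i
    have h := hpos (e i) (e.orthonormal.ne_zero i)
    rw [hAe, inner_smul_left, inner_self_eq_norm_sq_to_K, e.orthonormal.1 i] at h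
    simpa using h
  refine ⟨e, l, hl, ?_, fun v => (e.sum_sq_norm_inner_right v).symm, ?_, ?_⟩
  · intro i v
    have h := hsym (e i) v
    simp only [ContinuousLinearMap.coe_coe] at h
    rw [← h, hAe, inner_smul_left, Complex.conj_ofReal]
  · refine norm_opRPow_sq hpos e fun i => ?_
    rw [add_halves, opRPow_one hA, hAe]
  · refine norm_opRPow_sq hpos e fun i => ?_
    have h1 : opRPow A (-1) (A (e i)) = e i := by
      have h := opRPow_mul_opRPow hpos (-1) 1
      rw [neg_add_cancel, opRPow_zero hA, opRPow_one hA] at h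
      simpa using congrArg (fun B : V →L[ℂ] V => B (e i)) h
    rw [← neg_add, add_halves]
    rw [hAe, map_smul] at h1
    have hne : (l i : ℂ) ≠ 0 := by exact_mod_cast (hl i).ne'
    rw [← h1, smul_smul, Complex.ofReal_inv, inv_mul_cancel₀ hne, one_smul, h1]

end Spectral

lemma norm_sq_convolution_le {k : ℕ → ℝ} (hk : ∀ n, 0 ≤ k n)
    (hsum : ∀ n, ∑ j ∈ Finset.range n, k j ≤ 1) (g : ℕ → ℂ) (n : ℕ) :
    ‖∑ j ∈ Finset.range (n + 1), (k (n - j) : ℂ) * g j‖ ^ 2 ≤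
      ∑ j ∈ Finset.range (n + 1), k (n - j) * ‖g j‖ ^ 2 := by
  have h1 : ‖∑ j ∈ Finset.range (n + 1), (k (n - j) : ℂ) * g j‖ ≤
      ∑ j ∈ Finset.range (n + 1), k (n - j) * ‖g j‖ := by
    refine (norm_sum_le _ _).trans_eq (Finset.sum_congr rfl fun j _ => ?_)
    rw [norm_mul, Complex.norm_real, Real.norm_of_nonneg (hk _)]
  have h2 := Finset.sum_sq_le_sum_mul_sum_of_sq_le_mul (Finset.range (n + 1))
    (r := fun j => k (n - j) * ‖g j‖) (f := fun j => k (n - j))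
    (g := fun j => k (n - j) * ‖g j‖ ^ 2) (fun j _ => hk _)
    (fun j _ => mul_nonneg (hk _) (sq_nonneg _)) (fun j _ => le_of_eq (by ring))
  have h3 : ∑ j ∈ Finset.range (n + 1), k (n - j) ≤ 1 := by
    have h := Finset.sum_range_reflect k (n + 1)
    simp only [Nat.add_sub_cancel] at h
    rw [h]
    exact hsum (n + 1)
  have h4 : 0 ≤ ∑ j ∈ Finset.range (n + 1), k (n - j) * ‖g j‖ ^ 2 :=
    Finset.sum_nonneg fun j _ => mul_nonneg (hk _) (sq_nonneg _)
  calc _ ≤ (∑ j ∈ Finset.range (n + 1), k (n - j) * ‖g j‖) ^ 2 := by gcongr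
    _ ≤ _ := h2
    _ ≤ _ := mul_le_of_le_one_left h4 h3

/-- The discrete fractional integral of order `α` maps `ℓ^r` boundedly into `ℓ^∞` when
`1 / α < r`. -/
lemma fractional_integral_le {α r T : ℝ} (h0 : 0 < α) (h1 : α < 1) (hr1 : 1 < r)
    (hr : 1 / α < r) :
    ∃ C : ℝ, 0 ≤ C ∧ ∀ τ : ℝ, 0 < τ → ∀ n : ℕ, 1 ≤ n → (n : ℝ) * τ ≤ T →
      ∀ a : ℕ → ℝ, (∀ j, 0 ≤ a j) → a 0 = 0 →
        τ ^ α * ∑ j ∈ Finset.range (n + 1), cqWeight (-α) (n - j) * a j ≤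
          C * (τ * ∑ j ∈ Finset.range (n + 1), a j ^ r) ^ (1 / r) := by
  have hpr : r.HolderConjugate r.conjExponent := Real.HolderConjugate.conjExponent hr1
  set p := r.conjExponent
  have hr0 : 0 < r := hpr.pos
  have hp0 : 0 < p := hpr.symm.pos
  have hinv : 1 / r + 1 / p = 1 := by simpa using hpr.inv_add_inv_eq_one
  have hγ : 0 < α - 1 / r := by
    have := (div_lt_comm₀ h0 hr0).mp hr
    linarith
  have hs1 : 1 - (1 - α) * p = (α - 1 / r) * p := by
    have : 1 = p * (1 / p) := by field_simp
    have h2 : 1 / p = 1 - 1 / r := by linarith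
    rw [h2] at this
    linear_combination this
  have hs0 : 0 < (1 - α) * p := mul_pos (by linarith) hp0
  have hs : 0 < 1 - (1 - α) * p := hs1 ▸ mul_pos hγ hp0
  set D := (1 / (1 - (1 - α) * p)) ^ (1 / p) with hD
  have hD0 : 0 ≤ D := by positivity
  rcases le_or_gt T 0 with hT | hT
  · refine ⟨0, le_rfl, fun τ hτ n hn hnT => ?_⟩
    have : 0 < (n : ℝ) * τ := mul_pos (by exact_mod_cast hn) hτ
    linarith
  refine ⟨D * T ^ (α - 1 / r), by positivity, fun τ hτ n hn hnT a ha ha0 => ?_⟩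
  have hn0 : (0 : ℝ) < n := by exact_mod_cast hn
  rw [Finset.sum_range_succ', Finset.sum_range_succ' (fun j => a j ^ r), ha0,
    Real.zero_rpow hr0.ne', mul_zero, add_zero, add_zero]
  have hcq : ∀ m, 0 ≤ cqWeight (-α) m := fun m => (cqWeight_neg_pos h0 m).le
  have hH := Real.inner_le_Lp_mul_Lq_of_nonneg (Finset.range n) hpr.symm
    (f := fun j => cqWeight (-α) (n - (j + 1))) (g := fun j => a (j + 1))
    (fun j _ => hcq _) (fun j _ => ha _)
  have hsum : ∑ j ∈ Finset.range n, cqWeight (-α) (n - (j + 1)) ^ p ≤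
      (n : ℝ) ^ (1 - (1 - α) * p) * (1 / (1 - (1 - α) * p)) := by
    have h := Finset.sum_range_reflect (fun m => cqWeight (-α) m ^ p) n
    simp only [Nat.sub_sub, add_comm 1] at h
    rw [h, mul_one_div]
    refine le_trans (Finset.sum_le_sum fun m _ => ?_) (sum_rpow_neg_le hs0 (by linarith) n)
    refine (Real.rpow_le_rpow (hcq m) (cqWeight_neg_le_rpow h0 h1 m) hp0.le).trans_eq ?_
    rw [← Real.rpow_mul (by positivity)]
    congr 1
    ring
  have hsum' : (∑ j ∈ Finset.range n, cqWeight (-α) (n - (j + 1)) ^ p) ^ (1 / p) ≤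
      (n : ℝ) ^ (α - 1 / r) * D := by
    refine (Real.rpow_le_rpow (Finset.sum_nonneg fun j _ => Real.rpow_nonneg (hcq _) _) hsum
      (by positivity)).trans_eq ?_
    rw [Real.mul_rpow (by positivity) (by positivity), ← Real.rpow_mul hn0.le, ← hD]
    congr 2
    rw [hs1]
    field_simp
  have hτT : τ ^ (α - 1 / r) * (n : ℝ) ^ (α - 1 / r) ≤ T ^ (α - 1 / r) := by
    rw [← Real.mul_rpow hτ.le hn0.le, mul_comm τ]
    exact Real.rpow_le_rpow (by positivity) hnT hγ.le
  have hX : 0 ≤ ∑ j ∈ Finset.range n, a (j + 1) ^ r :=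
    Finset.sum_nonneg fun j _ => Real.rpow_nonneg (ha _) _
  set X := ∑ j ∈ Finset.range n, a (j + 1) ^ r
  have hXr : 0 ≤ X ^ (1 / r) := Real.rpow_nonneg hX _
  have hτs : τ ^ α = τ ^ (α - 1 / r) * τ ^ (1 / r) := by
    rw [← Real.rpow_add hτ, sub_add_cancel]
  calc τ ^ α * ∑ j ∈ Finset.range n, cqWeight (-α) (n - (j + 1)) * a (j + 1)
      ≤ τ ^ α * ((n : ℝ) ^ (α - 1 / r) * D * X ^ (1 / r)) := by
        refine mul_le_mul_of_nonneg_left (hH.trans ?_) (by positivity)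
        exact mul_le_mul_of_nonneg_right hsum' hXr
    _ = (τ ^ (α - 1 / r) * (n : ℝ) ^ (α - 1 / r)) * (D * (τ ^ (1 / r) * X ^ (1 / r))) := by
        rw [hτs]; ring
    _ ≤ T ^ (α - 1 / r) * (D * (τ ^ (1 / r) * X ^ (1 / r))) := by
        refine mul_le_mul_of_nonneg_right hτT ?_
        positivity
    _ = D * T ^ (α - 1 / r) * (τ * X) ^ (1 / r) := by
        rw [Real.mul_rpow hτ.le hX]; ring

lemma sum_Icc_rpow_eq {x a : ℕ → ℝ} {q : ℝ} (hq : 0 < q) (hx : ∀ j, 0 ≤ x j) (ha0 : a 0 = 0)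
    (ha : ∀ j, 1 ≤ j → a j = x j ^ 2) (n : ℕ) :
    ∑ j ∈ Finset.Icc 1 n, x j ^ q = ∑ j ∈ Finset.range (n + 1), a j ^ (q / 2) := by
  rw [Finset.sum_range_succ', ha0, Real.zero_rpow (by positivity), add_zero,
    Finset.range_eq_Ico, Finset.sum_Ico_add' (fun j => a j ^ (q / 2)) 0 n 1]
  refine Finset.sum_congr ?_ fun j hj => ?_
  · ext j
    simp only [Finset.mem_Icc, Finset.mem_Ico]
    omega
  · rw [ha j (by simp only [Finset.mem_Ico] at hj; omega), ← Real.rpow_natCast,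
      ← Real.rpow_mul (hx j)]
    congr 1
    push_cast
    ring

/-- Stability of the backward Euler CQ scheme:
`‖U^n‖ + (τ Σ_{j=1}^n ‖A^{1/2} U^j‖^q)^{1/q} ≤ c (τ Σ_{j=1}^n ‖A^{-1/2} f^j‖^q)^{1/q}`
for `q ∈ (2/α, ∞)`. -/
theorem scheme_stability (α q T : ℝ) (hα0 : 0 < α) (hα1 : α < 1)
    (hq : 2 / α < q) (hT : 0 < T) :
    ∃ c : ℝ, 0 < c ∧
      ∀ (V : Type) (_ : NormedAddCommGroup V) (_ : InnerProductSpace ℂ V)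
        (_ : FiniteDimensional ℂ V) (_ : Nontrivial V)
        (A : V →L[ℂ] V), IsSelfAdjoint A →
        (∀ x : V, x ≠ 0 → 0 < (⟪A x, x⟫).re) →
        ∀ τ : ℝ, 0 < τ → ∀ N : ℕ, 1 ≤ N → (N : ℝ) * τ ≤ T → ∀ (f U : ℕ → V), U 0 = 0 →
        (∀ n : ℕ, 1 ≤ n → n ≤ N → cqDeriv α τ U n + A (U n) = f n) →
        ∀ n : ℕ, 1 ≤ n → n ≤ N →
          ‖U n‖ + (τ * ∑ j ∈ Finset.Icc 1 n, ‖opRPow A (1 / 2) (U j)‖ ^ q) ^ (1 / q)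
          ≤ c * (τ * ∑ j ∈ Finset.Icc 1 n, ‖opRPow A (-(1 / 2)) (f j)‖ ^ q) ^ (1 / q) := by
  have hr : 1 / α < q / 2 := by
    have : 2 / α = 2 * (1 / α) := by ring
    linarith
  have hr1 : 1 < q / 2 := lt_trans (by rw [lt_div_iff₀ hα0]; linarith) hr
  have hq0 : 0 < q := by linarith
  obtain ⟨C, hC0, hC⟩ := fractional_integral_le (T := T) hα0 hα1 hr1 hr
  refine ⟨√C + ((q / 2) ^ (q / 2)) ^ (1 / q), by positivity, ?_⟩
  intro V _ _ _ _ A hA hpos τ hτ N hN hNT f U hU0 hscheme n hn hnN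
  obtain ⟨e, l, hl, hAe, hnorm, hhalf, hneghalf⟩ := exists_diagonalization hA hpos
  have hτα : 0 < τ ^ α := Real.rpow_pos_of_pos hτ α
  have hμ : ∀ i, 0 < τ ^ α * l i := fun i => mul_pos hτα (hl i)
  choose k hk0 hkanti hksum hkle hkeq using fun i => exists_resolvent_kernel hα0 hα1 (hμ i)
  set g : Fin (Module.finrank ℂ V) → ℕ → ℂ := fun i j =>
    if j = 0 then 0 else ((l i)⁻¹ : ℝ) * ⟪e i, f j⟫ with hg
  set a : Fin (Module.finrank ℂ V) → ℕ → ℝ := fun i j => l i * ‖g i j‖ ^ 2 with ha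
  have ha0 : ∀ i j, 0 ≤ a i j := fun i j => mul_nonneg (hl i).le (sq_nonneg _)
  have hazero : ∑ i, a i 0 = 0 := by simp [ha, hg]
  have hasum : ∀ j, 1 ≤ j → ∑ i, a i j = ‖opRPow A (-(1 / 2)) (f j)‖ ^ 2 := by
    intro j hj
    rw [hneghalf]
    refine Finset.sum_congr rfl fun i _ => ?_
    have hli := (hl i).ne'
    simp only [ha, hg, if_neg (show j ≠ 0 by omega), norm_mul, Complex.norm_real,
      Real.norm_of_nonneg (inv_nonneg.mpr (hl i).le)]
    field_simp
  have hconv : ∀ i, ∀ m ≤ N, ⟪e i, U m⟫ =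
      ∑ j ∈ Finset.range (m + 1), (k i (m - j) : ℂ) * g i j := by
    intro i m hm
    refine eq_resolvent_convolution (hμ i) (hkeq i) (u := fun m => ⟪e i, U m⟫) (g := g i)
      (N := N) (by simp [hU0]) (by simp [hg]) (fun m hm1 hmN => ?_) hm
    have h := congrArg (fun v => ((τ ^ α : ℝ) : ℂ) * ⟪e i, v⟫) (hscheme m hm1 hmN)
    have hli : (l i : ℂ) ≠ 0 := by exact_mod_cast (hl i).ne'
    have hττ : ((τ ^ α : ℝ) : ℂ) * ((τ ^ (-α) : ℝ) : ℂ) = 1 := by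
      rw [← Complex.ofReal_mul, ← Real.rpow_add hτ]
      simp
    simp only [cqDeriv, inner_add_right, hAe, ← Complex.coe_smul, inner_smul_right,
      inner_sum] at h
    simp only [hg, if_neg (show m ≠ 0 by omega)]
    push_cast at h hττ ⊢
    rw [mul_add, ← mul_assoc, hττ, one_mul] at h
    rw [mul_assoc, h]
    field_simp
  have hUle : ∀ i, ∀ m ≤ N, ‖⟪e i, U m⟫‖ ^ 2 ≤
      ∑ j ∈ Finset.range (m + 1), k i (m - j) * ‖g i j‖ ^ 2 := fun i m hm => by
    rw [hconv i m hm]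
    exact norm_sq_convolution_le (hk0 i) (hksum i) (g i) m
  have hRHS := sum_Icc_rpow_eq (x := fun j => ‖opRPow A (-(1 / 2)) (f j)‖)
    (a := fun j => ∑ i, a i j) hq0 (fun j => norm_nonneg _) hazero hasum n
  have hLHS := sum_Icc_rpow_eq (x := fun j => ‖opRPow A (1 / 2) (U j)‖)
    (a := fun j => ‖opRPow A (1 / 2) (U j)‖ ^ 2) hq0 (fun j => norm_nonneg _)
    (by simp [hU0]) (fun j _ => rfl) n
  have hmax : ∑ j ∈ Finset.Icc 1 n, ‖opRPow A (1 / 2) (U j)‖ ^ q ≤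
      (q / 2) ^ (q / 2) * ∑ j ∈ Finset.Icc 1 n, ‖opRPow A (-(1 / 2)) (f j)‖ ^ q := by
    rw [hLHS, hRHS]
    refine le_trans (Finset.sum_le_sum fun m hm => ?_)
      (sum_convolution_rpow_le hk0 hkanti hksum ha0 hr1 (n + 1))
    have hmN : m ≤ N := by have := Finset.mem_range.mp hm; omega
    refine Real.rpow_le_rpow (sq_nonneg _) ?_ (by positivity)
    rw [hhalf]
    refine Finset.sum_le_sum fun i _ => ?_
    refine (mul_le_mul_of_nonneg_left (hUle i m hmN) (hl i).le).trans_eq ?_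
    rw [Finset.mul_sum]
    exact Finset.sum_congr rfl fun j _ => by simp only [ha]; ring
  have hsup : ‖U n‖ ^ 2 ≤
      C * (τ * ∑ j ∈ Finset.Icc 1 n, ‖opRPow A (-(1 / 2)) (f j)‖ ^ q) ^ (1 / (q / 2)) := by
    rw [hRHS]
    have hnT : (n : ℝ) * τ ≤ T :=
      (mul_le_mul_of_nonneg_right (by exact_mod_cast hnN) hτ.le).trans hNT
    refine le_trans ?_ (hC τ hτ n hn hnT (fun j => ∑ i, a i j)
      (fun j => Finset.sum_nonneg fun i _ => ha0 i j) hazero)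
    rw [hnorm, Finset.mul_sum]
    simp_rw [Finset.mul_sum]
    rw [Finset.sum_comm]
    refine Finset.sum_le_sum fun i _ => (hUle i n hnN).trans (Finset.sum_le_sum fun j _ => ?_)
    refine (mul_le_mul_of_nonneg_right (hkle i (n - j)) (sq_nonneg _)).trans_eq ?_
    simp only [ha]
    ring
  set F := ∑ j ∈ Finset.Icc 1 n, ‖opRPow A (-(1 / 2)) (f j)‖ ^ q
  have hF0 : 0 ≤ F := Finset.sum_nonneg fun j _ => by positivity
  have hτF : 0 ≤ τ * F := mul_nonneg hτ.le hF0
  rw [add_mul]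
  refine add_le_add ?_ ?_
  · refine le_of_sq_le_sq ?_ (by positivity)
    refine hsup.trans_eq ?_
    rw [mul_pow, Real.sq_sqrt hC0, ← Real.rpow_mul_natCast hτF]
    congr 2
    push_cast
    field_simp
  · rw [← Real.mul_rpow (by positivity) hτF]
    refine Real.rpow_le_rpow (by positivity) ?_ (by positivity)
    calc _ ≤ τ * ((q / 2) ^ (q / 2) * F) := mul_le_mul_of_nonneg_left hmax hτ.le
      _ = _ := by ring
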